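/- Let G be a finite connected simple graph with at least two vertices, let s be the number of vertices of G of degree 3, and let t be the number of vertices of G of degree at least 4. Then G has a spanning tree with at least (2/5)·t + (1/5)·s + 8/5 leaves. -/

import Mathlib

open scoped Classical

/-- The number of leaves (vertices of degree 1) of a graph `T` (intended: a tree). -/
noncomputable def leafCount {V : Type*} [Fintype V] (T : SimpleGraph V) : ℕ :=
  Fintype.card {v : V // T.degree v = 1}

namespace LeafyTree

variable {V : Type*} [Fintype V] (G : SimpleGraph V)

/-- The vertices that are neither in `I` nor adjacent to a vertex of `I`. -/
noncomputable def outside (I : Finset V) : Finset V :=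
  Finset.univ.filter fun v => v ∉ I ∧ ∀ u ∈ I, ¬ G.Adj u v

/-- The neighbours of `x` that are not dominated by `I`. -/
noncomputable def out (I : Finset V) (x : V) : Finset V :=
  (outside G I).filter (G.Adj x)

/-- The dominated vertices having an undominated neighbour. -/
noncomputable def live (I : Finset V) : Finset V :=
  Finset.univ.filter fun v => v ∉ outside G I ∧ (out G I v).Nonempty

/-- Four minus five times the weight of a vertex in the leaf bound. -/
noncomputable def gain (v : V) : ℕ :=
  if 4 ≤ G.degree v then 2 else if G.degree v = 3 then 3 else 4

/-- The potential of a partially grown tree with set of inner vertices `I`. -/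
noncomputable def potential (I : Finset V) : ℕ :=
  5 * I.card + ∑ v ∈ outside G I, (gain G v + 1) + (live G I).card +
    if outside G I = ∅ then 1 else 0

/-- The subgraph of `G` formed by the edges inside `I`. -/
def inside (I : Finset V) : SimpleGraph V where
  Adj u v := G.Adj u v ∧ u ∈ I ∧ v ∈ I
  symm := ⟨fun _ _ h => ⟨h.1.symm, h.2.2, h.2.1⟩⟩
  loopless := ⟨fun _ h => G.loopless.irrefl _ h.1⟩

/-- `I` is nonempty and induces a connected subgraph. -/
def Conn (I : Finset V) : Prop :=
  I.Nonempty ∧ ∀ u ∈ I, ∀ v ∈ I, (inside G I).Reachable u v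

variable {G} {I : Finset V}

lemma mem_outside {v : V} : v ∈ outside G I ↔ v ∉ I ∧ ∀ u ∈ I, ¬ G.Adj u v := by
  simp [outside]

lemma mem_out {x v : V} : v ∈ out G I x ↔ v ∈ outside G I ∧ G.Adj x v := by
  simp [out]

lemma mem_live {v : V} : v ∈ live G I ↔ v ∉ outside G I ∧ (out G I v).Nonempty := by
  simp [live]

lemma mem_live_of_adj {v u : V} (hv : v ∉ outside G I) (hu : u ∈ outside G I)
    (h : G.Adj v u) : v ∈ live G I :=
  mem_live.2 ⟨hv, u, mem_out.2 ⟨hu, h⟩⟩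

lemma notMem_of_mem_live {v : V} (h : v ∈ live G I) : v ∉ I := by
  obtain ⟨-, u, hu⟩ := mem_live.1 h
  rw [mem_out, mem_outside] at hu
  exact fun hv => hu.1.2 v hv hu.2

lemma exists_adj_of_mem_live {v : V} (h : v ∈ live G I) : ∃ u ∈ I, G.Adj u v := by
  have h1 := (mem_live.1 h).1
  have h2 := notMem_of_mem_live h
  rw [mem_outside] at h1
  push Not at h1
  exact h1 h2

lemma mem_outside_insert {p v : V} (hp : p ∉ outside G I) :
    v ∈ outside G (insert p I) ↔ v ∈ outside G I ∧ ¬ G.Adj p v := by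
  constructor
  · intro h
    rw [mem_outside] at h ⊢
    refine ⟨⟨fun hv => h.1 (Finset.mem_insert_of_mem hv),
      fun u hu => h.2 u (Finset.mem_insert_of_mem hu)⟩, h.2 p (Finset.mem_insert_self _ _)⟩
  · rintro ⟨h, hpv⟩
    have hne : v ≠ p := fun e => hp (e ▸ h)
    rw [mem_outside] at h ⊢
    refine ⟨by simp [hne, h.1], fun u hu => ?_⟩
    rcases Finset.mem_insert.1 hu with rfl | hu
    · exact hpv
    · exact h.2 u hu

lemma mem_out_insert {p x v : V} (hp : p ∉ outside G I) :
    v ∈ out G (insert p I) x ↔ v ∈ outside G I ∧ ¬ G.Adj p v ∧ G.Adj x v := by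
  rw [mem_out, mem_outside_insert hp, and_assoc]

lemma two_le_gain (v : V) : 2 ≤ gain G v := by
  unfold gain; split_ifs <;> omega

lemma four_le_degree_of_gain {v : V} (h : gain G v ≤ 2) : 4 ≤ G.degree v := by
  unfold gain at h; split_ifs at h <;> omega

lemma Conn.insert {p : V} (hI : Conn G I) (hp : p ∈ live G I) : Conn G (insert p I) := by
  obtain ⟨u, hu, hup⟩ := exists_adj_of_mem_live hp
  have hle : inside G I ≤ inside G (Insert.insert p I) := fun a b h =>
    ⟨h.1, Finset.mem_insert_of_mem h.2.1, Finset.mem_insert_of_mem h.2.2⟩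
  have key : ∀ a ∈ Insert.insert p I, (inside G (Insert.insert p I)).Reachable u a := by
    intro a ha
    rcases Finset.mem_insert.1 ha with rfl | ha
    · exact SimpleGraph.Adj.reachable
        ⟨hup, Finset.mem_insert_of_mem hu, Finset.mem_insert_self _ _⟩
    · exact (hI.2 u hu a ha).mono hle
  exact ⟨⟨p, Finset.mem_insert_self _ _⟩, fun a ha b hb => (key a ha).symm.trans (key b hb)⟩

lemma card_insert_live {p : V} (hp : p ∈ live G I) : (insert p I).card = I.card + 1 :=
  Finset.card_insert_of_notMem (notMem_of_mem_live hp)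

/-- The effect on the potential of making the live vertex `p` an inner vertex, where `D` is a set
of vertices that are not live afterwards. -/
lemma potential_insert {p : V} (hp : p ∈ live G I) (D : Finset V)
    (hD : D ⊆ (live G I ∪ out G I p).erase p)
    (hdead : ∀ d ∈ D, out G (insert p I) d = ∅) :
    potential G (insert p I) + ∑ a ∈ out G I p, gain G a + D.card ≤
      potential G I + 4 + if outside G (insert p I) = ∅ then 1 else 0 := by
  have hpo : p ∉ outside G I := (mem_live.1 hp).1
  have hO : outside G (insert p I) = outside G I \ out G I p := by
    ext v
    rw [mem_outside_insert hpo, Finset.mem_sdiff, mem_out]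
    tauto
  have hsub : out G I p ⊆ outside G I := Finset.filter_subset _ _
  have hsum := Finset.sum_sdiff (f := fun v => gain G v + 1) hsub
  rw [← hO, Finset.sum_add_distrib (s := out G I p)] at hsum
  simp only [Finset.sum_const, smul_eq_mul, mul_one] at hsum
  have hL : live G (insert p I) ⊆ ((live G I ∪ out G I p).erase p) \ D := by
    intro v hv
    obtain ⟨h1, u, hu⟩ := mem_live.1 hv
    have hvp : v ≠ p := by
      rintro rfl
      exact notMem_of_mem_live hv (Finset.mem_insert_self _ _)
    refine Finset.mem_sdiff.2 ⟨Finset.mem_erase.2 ⟨hvp, ?_⟩, fun hvD => ?_⟩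
    · rw [mem_out_insert hpo] at hu
      rw [mem_outside_insert hpo] at h1
      rw [Finset.mem_union]
      by_cases hvo : v ∈ outside G I
      · right
        rw [mem_out]
        tauto
      · exact Or.inl (mem_live_of_adj hvo hu.1 hu.2.2)
    · rw [hdead v hvD] at hu
      simp at hu
  have hc := Finset.card_le_card hL
  rw [Finset.card_sdiff_of_subset hD, Finset.card_erase_of_mem (Finset.mem_union_left _ hp)] at hc
  have hDc := Finset.card_le_card hD
  rw [Finset.card_erase_of_mem (Finset.mem_union_left _ hp)] at hDc
  have hu := Finset.card_union_le (live G I) (out G I p)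
  have hpos : 0 < (live G I ∪ out G I p).card :=
    Finset.card_pos.2 ⟨p, Finset.mem_union_left _ hp⟩
  have hne : outside G I ≠ ∅ := by
    obtain ⟨-, u, hu⟩ := mem_live.1 hp
    exact Finset.ne_empty_of_mem (mem_out.1 hu).1
  unfold potential
  rw [card_insert_live hp, if_neg hne]
  omega

lemma out_eq_empty_of_outside {x : V} (h : outside G I = ∅) : out G I x = ∅ := by
  simp [out, h]

lemma two_mul_card_le_sum_gain (A : Finset V) : 2 * A.card ≤ ∑ a ∈ A, gain G a := by
  rw [mul_comm, ← smul_eq_mul, ← Finset.sum_const]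
  exact Finset.sum_le_sum fun _ _ => two_le_gain _

lemma out_subset_erase {p : V} (hp : p ∈ live G I) :
    out G I p ⊆ (live G I ∪ out G I p).erase p := fun _ ha =>
  Finset.mem_erase.2 ⟨fun e => (mem_live.1 hp).1 (e ▸ (mem_out.1 ha).1),
    Finset.mem_union_right _ ha⟩

lemma potential_insert_of_three_le {p : V} (hp : p ∈ live G I) (h : 3 ≤ (out G I p).card) :
    potential G (insert p I) + 2 ≤ potential G I := by
  have hs := two_mul_card_le_sum_gain (G := G) (out G I p)
  by_cases ht : outside G (insert p I) = ∅
  · have := potential_insert hp (out G I p) (out_subset_erase hp)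
      fun d _ => out_eq_empty_of_outside ht
    rw [if_pos ht] at this
    omega
  · have := potential_insert hp ∅ (by simp) (by simp)
    rw [if_neg ht] at this
    omega

/-- Expanding a vertex with two undominated neighbours does not increase the potential, and
if it does not decrease it, then the expansion is of a very special form. -/
lemma potential_insert_of_two_le {p : V} (hp : p ∈ live G I) (h : 2 ≤ (out G I p).card)
    (hle : potential G I ≤ potential G (insert p I)) :
    potential G (insert p I) = potential G I ∧ (out G I p).card = 2 ∧
      (∀ a ∈ out G I p, 4 ≤ G.degree a ∧ (out G (insert p I) a).Nonempty) ∧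
      ∀ d ∈ live G I, d ≠ p → (out G (insert p I) d).Nonempty := by
  have hs := two_mul_card_le_sum_gain (G := G) (out G I p)
  by_cases ht : outside G (insert p I) = ∅
  · have := potential_insert hp (out G I p) (out_subset_erase hp)
      fun d _ => out_eq_empty_of_outside ht
    rw [if_pos ht] at this
    omega
  have h0 := potential_insert hp ∅ (by simp) (by simp)
  rw [if_neg ht, Finset.card_empty] at h0
  have hdead : ∀ d ∈ (live G I ∪ out G I p).erase p, (out G (insert p I) d).Nonempty := by
    intro d hd
    by_contra hne
    rw [Finset.not_nonempty_iff_eq_empty] at hne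
    have := potential_insert hp {d} (by simpa using hd) (by simpa using hne)
    rw [if_neg ht, Finset.card_singleton] at this
    omega
  refine ⟨by omega, by omega, fun a ha => ⟨four_le_degree_of_gain ?_,
    hdead a (out_subset_erase hp ha)⟩,
    fun d hd hdp => hdead d (Finset.mem_erase.2 ⟨hdp, Finset.mem_union_left _ hd⟩)⟩
  have h1 := Finset.add_sum_erase _ (gain G) ha
  have h2 := two_mul_card_le_sum_gain (G := G) ((out G I p).erase a)
  rw [Finset.card_erase_of_mem ha] at h2
  omega

lemma potential_insert_of_common {p c : V} (hp : p ∈ live G I) (hc : out G I p = {c})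
    (D : Finset V) (hD : D ⊆ (live G I).erase p) (h3 : 3 ≤ D.card)
    (hDc : ∀ d ∈ D, out G I d = {c}) :
    potential G (insert p I) + 1 ≤ potential G I := by
  have hpo : p ∉ outside G I := (mem_live.1 hp).1
  have hcp : c ∈ outside G I ∧ G.Adj p c := by rw [← mem_out, hc]; simp
  have hD' : D ⊆ (live G I ∪ out G I p).erase p :=
    hD.trans (Finset.erase_subset_erase _ Finset.subset_union_left)
  have hdead : ∀ d ∈ D, out G (insert p I) d = ∅ := by
    intro d hd
    refine Finset.eq_empty_of_forall_notMem fun v hv => ?_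
    rw [mem_out_insert hpo] at hv
    have : v ∈ out G I d := mem_out.2 ⟨hv.1, hv.2.2⟩
    rw [hDc d hd, Finset.mem_singleton] at this
    exact hv.2.1 (this ▸ hcp.2)
  have hg := two_le_gain (G := G) c
  by_cases ht : outside G (insert p I) = ∅
  · have hcD : c ∉ D := fun h => (mem_live.1 (Finset.mem_of_mem_erase (hD h))).1 hcp.1
    have := potential_insert hp (insert c D)
      (Finset.insert_subset (out_subset_erase hp (by simp [hc])) hD')
      fun d _ => out_eq_empty_of_outside ht
    rw [if_pos ht, hc, Finset.sum_singleton, Finset.card_insert_of_notMem hcD] at this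
    omega
  · have := potential_insert hp D hD' hdead
    rw [if_neg ht, hc, Finset.sum_singleton] at this
    omega

/-- If no larger connected set has smaller potential, then expanding a vertex with at least two
undominated neighbours leaves no other live vertex without undominated neighbours. -/
lemma exists_mem_out_not_adj {K : Finset V}
    (hI : ∀ J, Conn G J → I.card < J.card → potential G I ≤ potential G J)
    (hK : Conn G K) (hIK : I.card ≤ K.card) (hpot : potential G K ≤ potential G I)
    {r s : V} (hr : r ∈ live G K) (hs : s ∈ live G K) (hrs : s ≠ r)
    (h2 : 2 ≤ (out G K r).card) : ∃ u ∈ out G K s, ¬ G.Adj r u := by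
  have hc := card_insert_live hr
  obtain ⟨-, -, -, h⟩ := potential_insert_of_two_le hr h2
    (hpot.trans (hI _ (hK.insert hr) (by omega)))
  obtain ⟨u, hu⟩ := h s hs hrs
  rw [mem_out_insert (mem_live.1 hr).1] at hu
  exact ⟨u, mem_out.2 ⟨hu.1, hu.2.2⟩, hu.2.1⟩

/-- A connected set with a vertex having at least two undominated neighbours can be enlarged so
that the potential decreases. -/
theorem exists_potential_lt (hI : Conn G I) {p : V} (hp : p ∈ live G I)
    (h2 : 2 ≤ (out G I p).card) :
    ∃ J, Conn G J ∧ I.card < J.card ∧ potential G J < potential G I := by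
  induction hn : Fintype.card V - I.card using Nat.strong_induction_on generalizing I p with
  | _ n ih =>
  by_contra! hS
  have hpo := (mem_live.1 hp).1
  have hJ : Conn G (insert p I) := hI.insert hp
  have hJc := card_insert_live hp
  obtain ⟨heq, hcard, hnew, hold⟩ := potential_insert_of_two_le hp h2 (hS _ hJ (by omega))
  have hone : ∀ x ∈ live G (insert p I), (out G (insert p I) x).card ≤ 1 := by
    intro x hx
    by_contra! hx2
    have hle := Finset.card_le_univ (insert p I)
    obtain ⟨J', hJ', hc', hlt⟩ := ih _ (by omega) hJ hx hx2 rfl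
    have := hS J' hJ' (by omega)
    omega
  have hpadj : ∀ {x y}, out G I p = {x, y} → ∀ u ∈ outside G I, G.Adj p u ↔ u = x ∨ u = y := by
    intro x y hxy u hu
    have : u ∈ out G I p ↔ u = x ∨ u = y := by simp [hxy]
    rw [← this, mem_out]
    tauto
  have hnbr : ∀ x y, out G I p = {x, y} → x ≠ y → ∃ x', out G (insert p I) x = {x'} ∧
      ∃ Q : Finset V, (∀ q ∈ Q, q ∉ outside G I ∧ q ≠ p ∧ G.Adj q x) ∧
        (¬ G.Adj x y → 2 ≤ Q.card) ∧ 1 ≤ Q.card := by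
    intro x y hxy hne
    have hx : x ∈ out G I p := by simp [hxy]
    obtain ⟨hdeg, hout⟩ := hnew x hx
    have hxJ : x ∈ live G (insert p I) := by
      refine mem_live.2 ⟨fun h => ?_, hout⟩
      rw [mem_outside_insert hpo] at h
      exact h.2 (mem_out.1 hx).2
    obtain ⟨x', hx'⟩ := Finset.card_eq_one.1 (le_antisymm (hone x hxJ) hout.card_pos)
    refine ⟨x', hx', (G.neighborFinset x).filter fun q => q ∉ outside G I ∧ q ≠ p, ?_, ?_⟩
    · intro q hq
      rw [Finset.mem_filter, SimpleGraph.mem_neighborFinset] at hq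
      exact ⟨hq.2.1, hq.2.2, hq.1.symm⟩
    set Q := (G.neighborFinset x).filter fun q => q ∉ outside G I ∧ q ≠ p with hQ
    have hcov : ∀ u, G.Adj x u → u ∈ Q ∨ u = p ∨ u = x' ∨ u = y := by
      intro u hu
      by_cases huo : u ∈ outside G I
      · by_cases hpu : G.Adj p u
        · rcases (hpadj hxy u huo).1 hpu with rfl | rfl
          · exact absurd hu (G.loopless.irrefl _)
          · tauto
        · have : u ∈ out G (insert p I) x := (mem_out_insert hpo).2 ⟨huo, hpu, hu⟩
          rw [hx', Finset.mem_singleton] at this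
          tauto
      · by_cases hup : u = p
        · tauto
        · left
          rw [hQ, Finset.mem_filter, SimpleGraph.mem_neighborFinset]
          tauto
    rw [← SimpleGraph.card_neighborFinset_eq_degree] at hdeg
    constructor
    · intro hnadj
      have hsub : G.neighborFinset x ⊆ Q ∪ {p, x'} := by
        intro u hu
        rw [SimpleGraph.mem_neighborFinset] at hu
        have huy : u ≠ y := fun h => hnadj (h ▸ hu)
        have := hcov u hu
        simp only [Finset.mem_union, Finset.mem_insert, Finset.mem_singleton]
        tauto
      have h1 := Finset.card_le_card hsub
      have h3 := Finset.card_union_le Q {p, x'}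
      have h4 := Finset.card_le_two (a := p) (b := x')
      omega
    · have hsub : G.neighborFinset x ⊆ Q ∪ {p, x', y} := by
        intro u hu
        rw [SimpleGraph.mem_neighborFinset] at hu
        have := hcov u hu
        simp only [Finset.mem_union, Finset.mem_insert, Finset.mem_singleton]
        tauto
      have h1 := Finset.card_le_card hsub
      have h3 := Finset.card_union_le Q {p, x', y}
      have h4 := Finset.card_le_three (a := p) (b := x') (c := y)
      omega
  have hout : ∀ x ∈ out G I p, ∀ q, q ∉ outside G I → q ≠ p → G.Adj q x →
      q ∈ live G I ∧ potential G (insert q I) = potential G I ∧ ∃ q' ∈ outside G I,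
        ¬ G.Adj p q' ∧ ∀ u ∈ outside G I, G.Adj q u ↔ u = x ∨ u = q' := by
    intro x hx q hqo hqp hqx
    rw [mem_out] at hx
    have hq : q ∈ live G I := mem_live_of_adj hqo hx.1 hqx
    obtain ⟨q', hq'⟩ := hold q hq hqp
    rw [mem_out_insert hpo] at hq'
    have hne : x ≠ q' := fun h => hq'.2.1 (h ▸ hx.2)
    have hqc : 2 ≤ (out G I q).card := Finset.one_lt_card.2
      ⟨x, mem_out.2 ⟨hx.1, hqx⟩, q', mem_out.2 ⟨hq'.1, hq'.2.2⟩, hne⟩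
    obtain ⟨hqe, hqc', -, -⟩ := potential_insert_of_two_le hq hqc
      (hS _ (hI.insert hq) (by rw [card_insert_live hq]; omega))
    refine ⟨hq, hqe, q', hq'.1, hq'.2.1, fun u hu => ?_⟩
    have hsub : {x, q'} ⊆ out G I q := by
      intro u hu
      rcases Finset.mem_insert.1 hu with rfl | hu
      · exact mem_out.2 ⟨hx.1, hqx⟩
      · rw [Finset.mem_singleton.1 hu]
        exact mem_out.2 ⟨hq'.1, hq'.2.2⟩
    have := Finset.eq_of_subset_of_card_le hsub (by rw [hqc', Finset.card_pair hne])
    have hm : u ∈ out G I q ↔ u = x ∨ u = q' := by simp [← this]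
    rw [← hm, mem_out]
    tauto
  have hkill : ∀ x y, out G I p = {x, y} → x ≠ y → ∀ q q', q ∈ live G I →
      potential G (insert q I) = potential G I → ¬ G.Adj p q' →
      (∀ u ∈ outside G I, G.Adj q u ↔ u = x ∨ u = q') →
      ∀ r, r ∉ outside G I ∨ r = x → r ≠ p → G.Adj r y → ∀ r' ∈ outside G I, ¬ G.Adj p r' →
      G.Adj r r' → r' = q' := by
    intro x y hxy hne q q' hq hqe hpq' hqadj r hr hrp hry r' hr' hpr' hrr'
    by_contra hrq
    have hx : x ∈ outside G I ∧ G.Adj p x := mem_out.1 (by simp [hxy])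
    have hy : y ∈ outside G I ∧ G.Adj p y := mem_out.1 (by simp [hxy])
    have hqo := (mem_live.1 hq).1
    have hqy : ¬ G.Adj q y := by
      rw [hqadj y hy.1]
      rintro (h | h)
      · exact hne h.symm
      · exact hpq' (h ▸ hy.2)
    have hqr' : ¬ G.Adj q r' := by
      rw [hqadj r' hr']
      rintro (h | h)
      · exact hpr' (h ▸ hx.2)
      · exact hrq h
    have hyK : y ∈ outside G (insert q I) := (mem_outside_insert hqo).2 ⟨hy.1, hqy⟩
    have hrK : r ∉ outside G (insert q I) := by
      rw [mem_outside_insert hqo]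
      rintro ⟨h1, h2⟩
      rcases hr with hr | rfl
      · exact hr h1
      · exact h2 ((hqadj r hx.1).2 (Or.inl rfl))
    have hpK : p ∉ outside G (insert q I) := by
      rw [mem_outside_insert hqo]
      exact fun h => hpo h.1
    have hcq := card_insert_live hq
    obtain ⟨u, hu, hru⟩ := exists_mem_out_not_adj hS (hI.insert hq) (by omega) hqe.le
      (mem_live_of_adj hrK hyK hry) (mem_live_of_adj hpK hyK hy.2) hrp.symm
      (Finset.one_lt_card.2 ⟨y, mem_out.2 ⟨hyK, hry⟩, r',
        (mem_out_insert hqo).2 ⟨hr', hqr', hrr'⟩, fun h => hpr' (h ▸ hy.2)⟩)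
    rw [mem_out_insert hqo] at hu
    rcases (hpadj hxy u hu.1).1 hu.2.2 with rfl | rfl
    · exact hu.2.1 ((hqadj u hu.1).2 (Or.inl rfl))
    · exact hru hry
  obtain ⟨a, b, hab, hpab⟩ := Finset.card_eq_two.1 hcard
  have hpba : out G I p = {b, a} := by rw [hpab, Finset.pair_comm]
  have ha : a ∈ out G I p := by simp [hpab]
  have hb : b ∈ out G I p := by simp [hpab]
  obtain ⟨a', ha', A, hA, hA2, hA1⟩ := hnbr a b hpab hab
  obtain ⟨b', hb', B, hB, hB2, hB1⟩ := hnbr b a hpba hab.symm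
  obtain ⟨q, hqA⟩ := Finset.card_pos.1 hA1
  obtain ⟨hqo, hqp, hqa⟩ := hA q hqA
  obtain ⟨hq, hqe, c, hc, hpc, hqc⟩ := hout a ha q hqo hqp hqa
  have hrc : ∀ r ∈ B, r ∈ live G I ∧ potential G (insert r I) = potential G I ∧
      ∀ u ∈ outside G I, G.Adj r u ↔ u = b ∨ u = c := by
    intro r hrB
    obtain ⟨hro, hrp, hrb⟩ := hB r hrB
    obtain ⟨hr, hre, r', hr', hpr', hradj⟩ := hout b hb r hro hrp hrb
    have := hkill a b hpab hab q c hq hqe hpc hqc r (Or.inl hro) hrp hrb r' hr' hpr'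
      ((hradj r' hr').2 (Or.inr rfl))
    subst this
    exact ⟨hr, hre, hradj⟩
  have hbo := mem_out.1 hb
  have hbc : b ≠ c := fun h => hpc (h ▸ hbo.2)
  by_cases hadj : G.Adj a b
  · obtain ⟨r, hrB⟩ := Finset.card_pos.1 hB1
    obtain ⟨hro, hrp, hrb⟩ := hB r hrB
    obtain ⟨hr, hre, hradj⟩ := hrc r hrB
    have hout' : ∀ {x x'}, out G (insert p I) x = {x'} →
        x' ∈ outside G I ∧ ¬ G.Adj p x' ∧ G.Adj x x' := by
      intro x x' h
      rw [← mem_out_insert hpo, h]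
      simp
    have hao := mem_out.1 ha
    obtain ⟨ha1, ha2, ha3⟩ := hout' ha'
    obtain ⟨hb1, hb2, hb3⟩ := hout' hb'
    have hac : a' = c := hkill a b hpab hab q c hq hqe hpc hqc a (Or.inr rfl)
      hao.2.ne' hadj a' ha1 ha2 ha3
    have hbc' : b' = c := hkill b a hpba hab.symm r c hr hre hpc hradj b (Or.inr rfl)
      hbo.2.ne' hadj.symm b' hb1 hb2 hb3
    subst hac
    subst hbc'
    have hsingle : ∀ x ∈ out G I p, ∀ q, (∀ u ∈ outside G I, G.Adj q u ↔ u = x ∨ u = b') →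
        out G (insert p I) q = {b'} := by
      intro x hx q hq
      rw [mem_out] at hx
      ext u
      rw [mem_out_insert hpo, Finset.mem_singleton]
      constructor
      · rintro ⟨h1, h2, h3⟩
        rcases (hq u h1).1 h3 with rfl | h
        · exact absurd hx.2 h2
        · exact h
      · rintro rfl
        exact ⟨hc, hpc, (hq u hc).2 (Or.inr rfl)⟩
    have hlive : ∀ x, x ∉ outside G I ∨ G.Adj p x → out G (insert p I) x = {b'} →
        x ∈ live G (insert p I) := by
      intro x hx h
      refine mem_live.2 ⟨?_, by simp [h]⟩
      rw [mem_outside_insert hpo]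
      tauto
    have hqb : ¬ G.Adj q b := by
      rw [hqc b hbo.1]
      rintro (h | h)
      · exact hab h.symm
      · exact hbc h
    have hbq : b ≠ q := fun h => hqo (h ▸ hbo.1)
    have hbr : b ≠ r := fun h => hro (h ▸ hbo.1)
    have hqr : q ≠ r := fun h => hqb (h ▸ hrb)
    have haq : a ≠ q := fun h => hqo (h ▸ hao.1)
    have har : a ≠ r := fun h => hro (h ▸ hao.1)
    have hqs := hsingle a ha q hqc
    have hrs := hsingle b hb r hradj
    have haJ := hlive a (Or.inr hao.2) ha'
    have := potential_insert_of_common haJ ha' {b, q, r} (by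
        intro x hx
        simp only [Finset.mem_insert, Finset.mem_singleton] at hx
        rw [Finset.mem_erase]
        rcases hx with rfl | rfl | rfl
        · exact ⟨hab.symm, hlive _ (Or.inr hbo.2) hb'⟩
        · exact ⟨haq.symm, hlive _ (Or.inl hqo) hqs⟩
        · exact ⟨har.symm, hlive _ (Or.inl hro) hrs⟩)
      (by rw [Finset.card_eq_three.2 ⟨b, q, r, hbq, hbr, hqr, rfl⟩])
      (by
        intro x hx
        simp only [Finset.mem_insert, Finset.mem_singleton] at hx
        rcases hx with rfl | rfl | rfl
        · exact hb'
        · exact hqs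
        · exact hrs)
    have h3 := hS _ (hJ.insert haJ) (by rw [card_insert_live haJ]; omega)
    omega
  · obtain ⟨r, hr, s, hs, hrs⟩ := Finset.one_lt_card.1 (hB2 fun h => hadj h.symm)
    obtain ⟨hrl, -, hradj⟩ := hrc r hr
    obtain ⟨hsl, -, hsadj⟩ := hrc s hs
    obtain ⟨u, hu, hru⟩ := exists_mem_out_not_adj hS hI le_rfl le_rfl hrl hsl hrs.symm
      (Finset.one_lt_card.2 ⟨b, mem_out.2 ⟨hbo.1, (hB r hr).2.2⟩, c,
        mem_out.2 ⟨hc, (hradj c hc).2 (Or.inr rfl)⟩, hbc⟩)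
    rw [mem_out] at hu
    exact hru ((hradj u hu.1).2 ((hsadj u hu.1).1 hu.2))

/-- A connected set that is not dominating can be enlarged without increasing the potential. -/
theorem exists_potential_le (hG : G.Connected) (hI : Conn G I) (hne : (outside G I).Nonempty) :
    ∃ J, Conn G J ∧ I.card < J.card ∧ potential G J ≤ potential G I := by
  by_cases hone : ∃ p ∈ live G I, 2 ≤ (out G I p).card
  · obtain ⟨p, hp, h2⟩ := hone
    obtain ⟨J, h1, h2, h3⟩ := exists_potential_lt hI hp h2
    exact ⟨J, h1, h2, h3.le⟩
  push Not at hone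
  obtain ⟨x, y, hxy, hx, hy⟩ : ∃ x y, G.Adj x y ∧ x ∉ outside G I ∧ y ∈ outside G I := by
    obtain ⟨y, hy⟩ := hne
    obtain ⟨x, hx⟩ := hI.1
    obtain ⟨w⟩ := hG.preconnected y x
    obtain ⟨d, -, hd1, hd2⟩ := w.exists_boundary_dart (outside G I : Set V) (by exact_mod_cast hy)
      fun h => (mem_outside.1 (Finset.mem_coe.1 h)).1 hx
    exact ⟨d.snd, d.fst, d.adj.symm, by exact_mod_cast hd2, by exact_mod_cast hd1⟩
  have hout : ∀ z, z ∉ outside G I → G.Adj z y → z ∈ live G I ∧ out G I z = {y} := by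
    intro z hz hzy
    have hzl := mem_live_of_adj hz hy hzy
    obtain ⟨c, hc⟩ := Finset.card_eq_one.1
      (le_antisymm (Nat.lt_succ_iff.1 (hone z hzl)) (mem_live.1 hzl).2.card_pos)
    have hyc : y ∈ out G I z := mem_out.2 ⟨hy, hzy⟩
    rw [hc, Finset.mem_singleton] at hyc
    exact ⟨hzl, hyc ▸ hc⟩
  obtain ⟨hxl, hxo⟩ := hout x hx hxy
  have hxc := card_insert_live hxl
  have hJ := hI.insert hxl
  set D := ((G.neighborFinset y).filter fun z => z ∉ outside G I).erase x with hD
  have hDsub : D ⊆ (live G I ∪ out G I x).erase x := by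
    refine Finset.erase_subset_erase _ fun z hz => Finset.mem_union_left _ ?_
    rw [Finset.mem_filter, SimpleGraph.mem_neighborFinset] at hz
    exact (hout z hz.2 hz.1.symm).1
  have hdead : ∀ d ∈ D, out G (insert x I) d = ∅ := by
    intro d hd
    rw [hD, Finset.mem_erase, Finset.mem_filter, SimpleGraph.mem_neighborFinset] at hd
    refine Finset.eq_empty_of_forall_notMem fun u hu => ?_
    rw [mem_out_insert hx] at hu
    have : u ∈ out G I d := mem_out.2 ⟨hu.1, hu.2.2⟩
    rw [(hout d hd.2.2 hd.2.1.symm).2, Finset.mem_singleton] at this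
    exact hu.2.1 (this ▸ hxy)
  have houty : out G (insert x I) y = (G.neighborFinset y).filter fun z => z ∈ outside G I := by
    ext u
    rw [mem_out_insert hx, Finset.mem_filter, SimpleGraph.mem_neighborFinset]
    refine ⟨fun h => ⟨h.2.2, h.1⟩, fun h => ⟨h.2, fun hxu => ?_, h.1⟩⟩
    have : u ∈ out G I x := mem_out.2 ⟨h.2, hxu⟩
    rw [hxo, Finset.mem_singleton] at this
    exact G.loopless.irrefl y (this ▸ h.1)
  have hdeg : D.card + 1 + (out G (insert x I) y).card = G.degree y := by
    rw [houty, hD, Finset.card_erase_add_one, add_comm,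
      Finset.card_filter_add_card_filter_not, SimpleGraph.card_neighborFinset_eq_degree]
    rw [Finset.mem_filter, SimpleGraph.mem_neighborFinset]
    exact ⟨hxy.symm, hx⟩
  have hgain : gain G y = if 4 ≤ G.degree y then 2 else if G.degree y = 3 then 3 else 4 := rfl
  rcases (out G (insert x I) y).eq_empty_or_nonempty with hy0 | hy0
  · have hyD : y ∉ D := by
      rw [hD]
      simp
    have := potential_insert hxl (insert y D)
      (Finset.insert_subset (out_subset_erase hxl (by simp [hxo])) hDsub) (by
        intro d hd
        rcases Finset.mem_insert.1 hd with rfl | hd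
        · exact hy0
        · exact hdead d hd)
    rw [hxo, Finset.sum_singleton, Finset.card_insert_of_notMem hyD] at this
    rw [hy0, Finset.card_empty] at hdeg
    refine ⟨_, hJ, by omega, ?_⟩
    split_ifs at this hgain <;> omega
  · have ht : outside G (insert x I) ≠ ∅ := by
      obtain ⟨u, hu⟩ := hy0
      exact Finset.ne_empty_of_mem (mem_out.1 hu).1
    have := potential_insert hxl D hDsub hdead
    rw [hxo, Finset.sum_singleton, if_neg ht] at this
    have hyl : y ∈ live G (insert x I) := by
      refine mem_live.2 ⟨?_, hy0⟩
      rw [mem_outside_insert hx]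
      exact fun h => h.2 hxy
    have hyc := card_insert_live hyl
    by_cases h4 : 4 ≤ gain G y + D.card
    · exact ⟨_, hJ, by omega, by omega⟩
    by_cases h3 : 3 ≤ (out G (insert x I) y).card
    · have h5 := potential_insert_of_three_le hyl h3
      have := two_le_gain (G := G) y
      exact ⟨_, hJ.insert hyl, by omega, by omega⟩
    · obtain ⟨J, hJ', hc, hlt⟩ := exists_potential_lt hJ hyl (by split_ifs at hgain <;> omega)
      refine ⟨J, hJ', by omega, ?_⟩
      split_ifs at hgain <;> omega

theorem exists_dominating (hG : G.Connected) (hI : Conn G I) :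
    ∃ J, Conn G J ∧ outside G J = ∅ ∧ potential G J ≤ potential G I := by
  induction hn : Fintype.card V - I.card using Nat.strong_induction_on generalizing I with
  | _ n ih =>
  rcases (outside G I).eq_empty_or_nonempty with h | h
  · exact ⟨I, hI, h, le_rfl⟩
  obtain ⟨J, hJ, hc, hle⟩ := exists_potential_le hG hI h
  have := Finset.card_le_univ J
  obtain ⟨K, hK, hK0, hle'⟩ := ih _ (by omega) hJ rfl
  exact ⟨K, hK, hK0, hle'.trans hle⟩

/-- A connected dominating set is the complement of a set of leaves of a spanning tree. -/
theorem exists_tree_of_dominating (hV : 2 ≤ Fintype.card V) (hI : Conn G I)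
    (h0 : outside G I = ∅) :
    ∃ T ≤ G, T.IsTree ∧ Fintype.card V ≤ leafCount T + I.card := by
  have hex : ∀ v, ∃ u, v ∉ I → u ∈ I ∧ G.Adj u v := by
    intro v
    have hv : v ∉ outside G I := by simp [h0]
    rw [mem_outside] at hv
    push Not at hv
    by_cases hvI : v ∈ I
    · exact ⟨v, fun h => absurd hvI h⟩
    · obtain ⟨u, hu⟩ := hv hvI
      exact ⟨u, fun _ => hu⟩
  choose f hf using hex
  let H : SimpleGraph V :=
    { Adj := fun u v => G.Adj u v ∧ (u ∈ I ∧ v ∈ I ∨ u ∉ I ∧ v = f u ∨ v ∉ I ∧ u = f v)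
      symm := ⟨fun u v h => ⟨h.1.symm, by tauto⟩⟩
      loopless := ⟨fun u h => G.loopless.irrefl u h.1⟩ }
  have hHG : H ≤ G := fun _ _ h => h.1
  have hle : inside G I ≤ H := fun _ _ h => ⟨h.1, Or.inl h.2⟩
  obtain ⟨r, hr⟩ := hI.1
  have hreach : ∀ v, H.Reachable r v := by
    intro v
    by_cases hv : v ∈ I
    · exact (hI.2 r hr v hv).mono hle
    · have hadj : H.Adj (f v) v := ⟨(hf v hv).2, Or.inr (Or.inr ⟨hv, rfl⟩)⟩
      exact ((hI.2 r hr _ (hf v hv).1).mono hle).trans hadj.reachable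
  have hH : H.Connected :=
    { preconnected := fun u v => (hreach u).symm.trans (hreach v)
      nonempty := ⟨r⟩ }
  obtain ⟨T, hTH, hT⟩ := hH.exists_isTree_le
  refine ⟨T, hTH.trans hHG, hT, ?_⟩
  have : Nontrivial V := Fintype.one_lt_card_iff_nontrivial.1 hV
  have hdeg : ∀ v, v ∉ I → T.degree v = 1 := by
    intro v hv
    refine le_antisymm ?_ (hT.connected.preconnected.degree_pos_of_nontrivial v)
    rw [← SimpleGraph.card_neighborFinset_eq_degree]
    refine (Finset.card_le_card (t := {f v}) fun u hu => ?_).trans (Finset.card_singleton _).le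
    rw [SimpleGraph.mem_neighborFinset] at hu
    rw [Finset.mem_singleton]
    rcases (hTH hu).2 with h | h | h
    · exact absurd h.1 hv
    · exact h.2
    · exact absurd (h.2 ▸ (hf u h.1).1) hv
  have hsub : Finset.univ \ I ⊆ Finset.univ.filter fun v => T.degree v = 1 := by
    intro v hv
    simpa using hdeg v (Finset.mem_sdiff.1 hv).2
  have hc := Finset.card_le_card hsub
  rw [Finset.card_sdiff_of_subset (Finset.subset_univ _), Finset.card_univ] at hc
  unfold leafCount
  rw [Fintype.card_subtype]
  omega

lemma conn_singleton {W : Type*} {G : SimpleGraph W} (v : W) : Conn G {v} :=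
  ⟨⟨v, Finset.mem_singleton_self v⟩, fun a ha b hb => by
    rw [Finset.mem_singleton.1 ha, Finset.mem_singleton.1 hb]⟩

lemma outside_singleton (v : V) :
    outside G {v} = Finset.univ \ insert v (G.neighborFinset v) := by
  ext u
  simp [mem_outside]

lemma live_singleton_subset (v : V) : live G {v} ⊆ G.neighborFinset v := by
  intro u hu
  obtain ⟨w, hw, h⟩ := exists_adj_of_mem_live hu
  rw [Finset.mem_singleton] at hw
  rw [SimpleGraph.mem_neighborFinset]
  exact hw ▸ h

lemma potential_singleton (v : V) :
    potential G {v} + gain G v + ∑ u ∈ G.neighborFinset v, gain G u + G.degree v =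
      4 + ∑ u, (gain G u + 1) + (live G {v}).card + if outside G {v} = ∅ then 1 else 0 := by
  have h := Finset.sum_sdiff (f := fun u => gain G u + 1)
    (Finset.subset_univ (insert v (G.neighborFinset v)))
  rw [← outside_singleton, Finset.sum_insert (by simp),
    Finset.sum_add_distrib (s := G.neighborFinset v)] at h
  simp only [Finset.sum_const, smul_eq_mul, mul_one,
    SimpleGraph.card_neighborFinset_eq_degree] at h
  unfold potential
  rw [Finset.card_singleton]
  omega

lemma card_live_singleton_add_le {v : V} (h : 1 ≤ G.degree v) :
    (live G {v}).card + (if outside G {v} = ∅ then 1 else 0) ≤ G.degree v := by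
  split_ifs with ht
  · have : live G {v} = ∅ := Finset.eq_empty_of_forall_notMem fun u hu => by
      have := (mem_live.1 hu).2
      rw [out_eq_empty_of_outside ht] at this
      simp at this
    rw [this]
    simpa using h
  · have := Finset.card_le_card (live_singleton_subset (G := G) v)
    rwa [SimpleGraph.card_neighborFinset_eq_degree] at this

lemma mem_out_singleton {v z u : V} :
    u ∈ out G {v} z ↔ u ≠ v ∧ ¬ G.Adj v u ∧ G.Adj z u := by
  simp [mem_out, mem_outside, and_assoc]

/-- If no connected set has small potential, then the neighbourhood of a vertex of degree four in
a graph of maximum degree at most four is special. -/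
lemma of_degree_eq_four (hmax : ∀ v, G.degree v ≤ 4)
    (hlow : ∀ I, Conn G I → ∑ u, (gain G u + 1) < potential G I + 7) {v : V}
    (hv : G.degree v = 4) :
    potential G {v} + 6 ≤ ∑ u, (gain G u + 1) ∧ ∀ z, G.Adj v z → G.degree z = 4 ∧
      z ∈ live G {v} ∧ (out G {v} z).card = 1 ∧
      (G.neighborFinset v ∩ G.neighborFinset z).card = 2 := by
  have h1 := potential_singleton (G := G) v
  have h2 := card_live_singleton_add_le (G := G) (v := v) (by omega)
  have h3 := hlow _ (conn_singleton v)
  have h4 := two_mul_card_le_sum_gain (G := G) (G.neighborFinset v)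
  have h5 := two_le_gain (G := G) v
  rw [SimpleGraph.card_neighborFinset_eq_degree] at h4
  refine ⟨by omega, fun z hz => ?_⟩
  have hzN : z ∈ G.neighborFinset v := by simpa using hz
  have hnt : outside G {v} ≠ ∅ := by
    intro ht
    have : live G {v} = ∅ := Finset.eq_empty_of_forall_notMem fun u hu => by
      have := (mem_live.1 hu).2
      rw [out_eq_empty_of_outside ht] at this
      simp at this
    rw [this, if_pos ht, Finset.card_empty] at h1
    omega
  rw [if_neg hnt] at h1 h2
  have hlive : live G {v} = G.neighborFinset v :=
    Finset.eq_of_subset_of_card_le (live_singleton_subset v)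
      (by rw [SimpleGraph.card_neighborFinset_eq_degree]; omega)
  have hzl : z ∈ live G {v} := hlive ▸ hzN
  have hzd : G.degree z = 4 := by
    refine le_antisymm (hmax z) (four_le_degree_of_gain ?_)
    have h6 := Finset.add_sum_erase _ (gain G) hzN
    have h7 := two_mul_card_le_sum_gain (G := G) ((G.neighborFinset v).erase z)
    rw [Finset.card_erase_of_mem hzN, SimpleGraph.card_neighborFinset_eq_degree] at h7
    omega
  have hzo : (out G {v} z).card = 1 := by
    refine le_antisymm ?_ (mem_live.1 hzl).2.card_pos
    by_contra! hc
    obtain ⟨J, hJ, -, hlt⟩ := exists_potential_lt (conn_singleton v) hzl hc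
    have := hlow J hJ
    omega
  refine ⟨hzd, hzl, hzo, ?_⟩
  have hsplit : G.neighborFinset z =
      insert v (out G {v} z ∪ (G.neighborFinset v ∩ G.neighborFinset z)) := by
    ext u
    simp only [SimpleGraph.mem_neighborFinset, Finset.mem_insert, Finset.mem_union,
      mem_out_singleton, Finset.mem_inter]
    have : u = v → G.Adj z u := fun h => h ▸ hz.symm
    tauto
  have hdisj : Disjoint (out G {v} z) (G.neighborFinset v ∩ G.neighborFinset z) := by
    rw [Finset.disjoint_left]
    intro u hu
    rw [mem_out_singleton] at hu
    simp [hu.2.1]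
  have h8 := congrArg Finset.card hsplit
  rw [SimpleGraph.card_neighborFinset_eq_degree, Finset.card_insert_of_notMem
    (by simp [mem_out_singleton]), Finset.card_union_of_disjoint hdisj] at h8
  omega

/-- In a graph of maximum degree four, some connected set has small potential. -/
lemma exists_potential_of_degree_eq_four (hmax : ∀ v, G.degree v ≤ 4) {v : V}
    (hv : G.degree v = 4) :
    ∃ I, Conn G I ∧ potential G I + 7 ≤ ∑ u, (gain G u + 1) := by
  by_contra! hlow
  obtain ⟨hpot, hnb⟩ := of_degree_eq_four hmax hlow hv
  have hcommon : ∀ {a b}, G.degree a = 4 → G.Adj a b →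
      (G.neighborFinset a ∩ G.neighborFinset b).card = 2 :=
    fun ha hab => ((of_degree_eq_four hmax hlow ha).2 _ hab).2.2.2
  obtain ⟨z, hz⟩ : (G.neighborFinset v).Nonempty := by
    rw [← Finset.card_pos, SimpleGraph.card_neighborFinset_eq_degree]
    omega
  rw [SimpleGraph.mem_neighborFinset] at hz
  obtain ⟨hzd, hzl, hzo, hzc⟩ := hnb z hz
  obtain ⟨x, y, hxy, hvz⟩ := Finset.card_eq_two.1 hzc
  obtain ⟨o, ho⟩ := Finset.card_eq_one.1 hzo
  have mvz : ∀ w, G.Adj v w ∧ G.Adj z w ↔ w = x ∨ w = y := by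
    intro w
    have := congrArg (w ∈ ·) hvz
    simpa using this
  have hx := (mvz x).2 (Or.inl rfl)
  have hy := (mvz y).2 (Or.inr rfl)
  have hoz : o ≠ v ∧ ¬ G.Adj v o ∧ G.Adj z o := by
    rw [← mem_out_singleton, ho]
    simp
  have hsub : {z, x, y} ⊆ G.neighborFinset v := by
    intro w hw
    simp only [Finset.mem_insert, Finset.mem_singleton] at hw
    rw [SimpleGraph.mem_neighborFinset]
    rcases hw with rfl | rfl | rfl
    exacts [hz, hx.1, hy.1]
  have h3 : ({z, x, y} : Finset V).card = 3 :=
    Finset.card_eq_three.2 ⟨z, x, y, hx.2.ne, hy.2.ne, hxy, rfl⟩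
  obtain ⟨u, hu⟩ : (G.neighborFinset v \ {z, x, y}).Nonempty := by
    rw [← Finset.card_pos, Finset.card_sdiff_of_subset hsub, h3,
      SimpleGraph.card_neighborFinset_eq_degree]
    omega
  simp only [Finset.mem_sdiff, SimpleGraph.mem_neighborFinset, Finset.mem_insert,
    Finset.mem_singleton, not_or] at hu
  obtain ⟨huv, huz, hux, huy⟩ := hu
  have hNv : ∀ w, G.Adj v w → w = z ∨ w = x ∨ w = y ∨ w = u := by
    have h4 : insert u {z, x, y} = G.neighborFinset v := by
      refine Finset.eq_of_subset_of_card_le ?_ ?_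
      · refine Finset.insert_subset ?_ hsub
        simpa using huv
      · rw [Finset.card_insert_of_notMem (by simp [huz, hux, huy]), h3,
          SimpleGraph.card_neighborFinset_eq_degree, hv]
    intro w hw
    rw [← SimpleGraph.mem_neighborFinset, ← h4] at hw
    simp only [Finset.mem_insert, Finset.mem_singleton] at hw
    tauto
  have hzu : ¬ G.Adj z u := fun h => by
    have := (mvz u).1 ⟨huv, h⟩
    tauto
  -- If the common neighbours of an edge lie in a pair, then they form this pair.
  have pair : ∀ {a b p q}, G.degree a = 4 → G.Adj a b →
      (∀ w, G.Adj a w → G.Adj b w → w = p ∨ w = q) →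
      (G.Adj a p ∧ G.Adj b p) ∧ (G.Adj a q ∧ G.Adj b q) ∧ p ≠ q := by
    intro a b p q ha hab h
    have hc := hcommon ha hab
    have hs : G.neighborFinset a ∩ G.neighborFinset b ⊆ {p, q} := by
      intro w hw
      simp only [Finset.mem_inter, SimpleGraph.mem_neighborFinset] at hw
      simpa using h w hw.1 hw.2
    have he := Finset.eq_of_subset_of_card_le hs (by rw [hc]; exact Finset.card_le_two)
    refine ⟨?_, ?_, fun e => ?_⟩
    · have : p ∈ G.neighborFinset a ∩ G.neighborFinset b := by simp [he]
      simpa using this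
    · have : q ∈ G.neighborFinset a ∩ G.neighborFinset b := by simp [he]
      simpa using this
    · rw [he, e] at hc
      simp at hc
  have hvu := pair hv huv (p := x) (q := y) fun w h1 h2 => by
    rcases hNv w h1 with rfl | rfl | rfl | rfl
    · exact absurd h2.symm hzu
    · exact Or.inl rfl
    · exact Or.inr rfl
    · exact absurd h2 (G.loopless.irrefl _)
  have hNz : ∀ w, G.Adj z w → w = v ∨ w = x ∨ w = y ∨ w = o := by
    intro w hw
    by_cases hwv : w = v
    · exact Or.inl hwv
    by_cases hvw : G.Adj v w
    · have := (mvz w).1 ⟨hvw, hw⟩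
      tauto
    · have : w ∈ out G {v} z := mem_out_singleton.2 ⟨hwv, hvw, hw⟩
      rw [ho, Finset.mem_singleton] at this
      tauto
  have hxy' : ¬ G.Adj x y := by
    intro h
    have hc := hcommon hv hx.1
    have hs : {z, y, u} ⊆ G.neighborFinset v ∩ G.neighborFinset x := by
      intro w hw
      simp only [Finset.mem_insert, Finset.mem_singleton] at hw
      simp only [Finset.mem_inter, SimpleGraph.mem_neighborFinset]
      rcases hw with rfl | rfl | rfl
      exacts [⟨hz, hx.2.symm⟩, ⟨hy.1, h⟩, ⟨huv, hvu.1.2.symm⟩]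
    have := Finset.card_le_card hs
    rw [Finset.card_eq_three.2 ⟨z, y, u, hy.2.ne, Ne.symm huz, Ne.symm huy, rfl⟩] at this
    omega
  have hzx := pair hzd hx.2 (p := v) (q := o) fun w h1 h2 => by
    rcases hNz w h1 with rfl | rfl | rfl | rfl
    · exact Or.inl rfl
    · exact absurd h2 (G.loopless.irrefl _)
    · exact absurd h2 hxy'
    · exact Or.inr rfl
  have hzy := pair hzd hy.2 (p := v) (q := o) fun w h1 h2 => by
    rcases hNz w h1 with rfl | rfl | rfl | rfl
    · exact Or.inl rfl
    · exact absurd h2.symm hxy'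
    · exact absurd h2 (G.loopless.irrefl _)
    · exact Or.inr rfl
  obtain ⟨hxd, hxl, hxo, -⟩ := hnb x hx.1
  obtain ⟨hyd, hyl, hyo, -⟩ := hnb y hy.1
  obtain ⟨-, hul, huo, -⟩ := hnb u huv
  have hout : ∀ w, G.Adj w o → (out G {v} w).card = 1 → out G {v} w = {o} := by
    intro w hw hc
    obtain ⟨o', ho'⟩ := Finset.card_eq_one.1 hc
    have : o ∈ out G {v} w := mem_out_singleton.2 ⟨hoz.1, hoz.2.1, hw⟩
    rw [ho', Finset.mem_singleton] at this
    rw [ho', this]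
  have hxout := hout x hzx.2.1.2 hxo
  have hNx : ∀ w, G.Adj x w → w = v ∨ w = z ∨ w = u ∨ w = o := by
    intro w hw
    by_cases hwv : w = v
    · exact Or.inl hwv
    by_cases hvw : G.Adj v w
    · rcases hNv w hvw with rfl | rfl | rfl | rfl
      · tauto
      · exact absurd hw (G.loopless.irrefl _)
      · exact absurd hw hxy'
      · tauto
    · have : w ∈ out G {v} x := mem_out_singleton.2 ⟨hwv, hvw, hw⟩
      rw [hxout, Finset.mem_singleton] at this
      tauto
  have hxu := pair hxd hvu.1.2.symm (p := v) (q := o) fun w h1 h2 => by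
    rcases hNx w h1 with rfl | rfl | rfl | rfl
    · exact Or.inl rfl
    · exact absurd h2.symm hzu
    · exact absurd h2 (G.loopless.irrefl _)
    · exact Or.inr rfl
  have hfin := potential_insert_of_common hzl ho {x, y, u} (by
      intro w hw
      simp only [Finset.mem_insert, Finset.mem_singleton] at hw
      rw [Finset.mem_erase]
      rcases hw with rfl | rfl | rfl
      exacts [⟨hx.2.ne', hxl⟩, ⟨hy.2.ne', hyl⟩, ⟨huz, hul⟩])
    (by rw [Finset.card_eq_three.2 ⟨x, y, u, hxy, Ne.symm hux, Ne.symm huy, rfl⟩])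
    (by
      intro w hw
      simp only [Finset.mem_insert, Finset.mem_singleton] at hw
      rcases hw with rfl | rfl | rfl
      exacts [hxout, hout _ hzy.2.1.2 hyo, hout _ hxu.2.1.2 huo])
  have := hlow _ ((conn_singleton v).insert hzl)
  omega

lemma exists_potential_of_two_le_degree {w : V} (hw : 2 ≤ G.degree w) :
    ∃ I, Conn G I ∧ potential G I + 7 ≤ ∑ u, (gain G u + 1) := by
  have : Nonempty V := ⟨w⟩
  obtain ⟨v, hv⟩ := G.exists_maximal_degree_vertex
  have hmax : ∀ u, G.degree u ≤ G.degree v := fun u => hv ▸ G.degree_le_maxDegree u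
  have hd := hw.trans (hmax w)
  have h1 := potential_singleton (G := G) v
  have h2 := card_live_singleton_add_le (G := G) (v := v) (by omega)
  have hg : ∀ g, (∀ u, g ≤ gain G u) → G.degree v * g ≤ ∑ u ∈ G.neighborFinset v, gain G u := by
    intro g h
    rw [← SimpleGraph.card_neighborFinset_eq_degree, ← smul_eq_mul, ← Finset.sum_const]
    exact Finset.sum_le_sum fun u _ => h u
  rcases Nat.lt_or_ge 4 (G.degree v) with h5 | h4
  · have := hg 2 two_le_gain
    have := two_le_gain (G := G) v
    exact ⟨_, conn_singleton v, by omega⟩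
  rcases h4.eq_or_lt with h4 | h4
  · exact exists_potential_of_degree_eq_four (fun u => h4 ▸ hmax u) h4
  rcases (Nat.le_of_lt_succ h4).eq_or_lt with h3 | h3
  · have hge : ∀ u, 3 ≤ gain G u := by
      intro u
      have := hmax u
      unfold gain
      split_ifs <;> omega
    have := hg 3 hge
    have := hge v
    exact ⟨_, conn_singleton v, by omega⟩
  · have hge : ∀ u, 4 ≤ gain G u := by
      intro u
      have := hmax u
      unfold gain
      split_ifs <;> omega
    have := hg 4 hge
    have := hge v
    exact ⟨_, conn_singleton v, by omega⟩

lemma sum_gain_add_weights :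
    ∑ u, (gain G u + 1) + 2 * Fintype.card {v : V // 4 ≤ G.degree v} +
      Fintype.card {v : V // G.degree v = 3} = 5 * Fintype.card V := by
  rw [Fintype.card_subtype, Fintype.card_subtype, Finset.card_filter, Finset.card_filter,
    Finset.mul_sum, ← Finset.sum_add_distrib, ← Finset.sum_add_distrib, mul_comm,
    ← smul_eq_mul, ← Finset.card_univ, ← Finset.sum_const]
  refine Finset.sum_congr rfl fun u _ => ?_
  unfold gain
  split_ifs <;> omega

theorem exists_isTree_two_mul_add_le (hG : G.Connected) (hV : 2 ≤ Fintype.card V) :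
    ∃ T ≤ G, T.IsTree ∧ 2 * Fintype.card {v : V // 4 ≤ G.degree v} +
      Fintype.card {v : V // G.degree v = 3} + 8 ≤ 5 * leafCount T := by
  have hsum := sum_gain_add_weights (G := G)
  by_cases hdeg : ∃ w, 2 ≤ G.degree w
  · obtain ⟨w, hw⟩ := hdeg
    obtain ⟨I, hI, hpot⟩ := exists_potential_of_two_le_degree hw
    obtain ⟨J, hJ, h0, hle⟩ := exists_dominating hG hI
    obtain ⟨T, hTG, hT, hleaf⟩ := exists_tree_of_dominating hV hJ h0
    refine ⟨T, hTG, hT, ?_⟩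
    unfold potential at hle hpot
    rw [if_pos h0] at hle
    omega
  · push Not at hdeg
    obtain ⟨T, hTG, hT⟩ := hG.exists_isTree_le
    refine ⟨T, hTG, hT, ?_⟩
    have : Nontrivial V := Fintype.one_lt_card_iff_nontrivial.1 hV
    have h1 : ∀ v, T.degree v = 1 := fun v =>
      le_antisymm ((SimpleGraph.degree_le_of_le hTG).trans (Nat.le_of_lt_succ (hdeg v)))
        (hT.connected.preconnected.degree_pos_of_nontrivial v)
    have h4 : Fintype.card {v : V // 4 ≤ G.degree v} = 0 :=
      Fintype.card_eq_zero_iff.2 ⟨fun v => by have := hdeg v.1; have := v.2; omega⟩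
    have h3 : Fintype.card {v : V // G.degree v = 3} = 0 :=
      Fintype.card_eq_zero_iff.2 ⟨fun v => by have := hdeg v.1; have := v.2; omega⟩
    have hl : leafCount T = Fintype.card V := by
      unfold leafCount
      rw [Fintype.card_subtype, Finset.filter_true_of_mem fun v _ => h1 v, Finset.card_univ]
    omega

end LeafyTree

/-- Every connected graph with at least two vertices, `s` vertices of degree 3 and
`t` vertices of degree at least 4 has a spanning tree with at least
`(2/5)·t + (1/5)·s + 8/5` leaves. -/
theorem spanning_tree_leaves_ge_two_fifths_t_one_fifth_s_add_eight_fifths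
    {V : Type*} [Fintype V] (G : SimpleGraph V) (hG : G.Connected)
    (hV : 2 ≤ Fintype.card V) :
    ∃ T ≤ G, T.IsTree ∧
      (2 / 5 : ℚ) * (Fintype.card {v : V // 4 ≤ G.degree v}) +
        (1 / 5 : ℚ) * (Fintype.card {v : V // G.degree v = 3}) + 8 / 5 ≤ leafCount T := by
  obtain ⟨T, hTG, hT, h⟩ := LeafyTree.exists_isTree_two_mul_add_le hG hV
  refine ⟨T, hTG, hT, ?_⟩
  have h' : (2 * (Fintype.card {v : V // 4 ≤ G.degree v}) +
      (Fintype.card {v : V // G.degree v = 3}) + 8 : ℚ) ≤ 5 * leafCount T := by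
    exact_mod_cast h
  linarith
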